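/- arXiv:1112.3285 — 2 statements merged into one kernel-verified Lean document; each statement's English description precedes it below -/
import Mathlib

section
/- For every θ > 0 and all Schwartz functions a, b : ℝ² → ℂ, the L²-norm of the Moyal product satisfies ‖a ⋆ b‖_{L²(ℝ²)} ≤ (2πθ)^{−1/2} ‖a‖_{L²(ℝ²)} ‖b‖_{L²(ℝ²)}. -/
open MeasureTheory Complex

noncomputable section

abbrev E2 := EuclideanSpace ℝ (Fin 2)

/-- The Moyal star product on ℝ² with deformation parameter θ. -/
def moyal (θ : ℝ) (f g : E2 → ℂ) : E2 → ℂ := fun x =>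
  (((Real.pi * θ) ^ 2)⁻¹ : ℝ) • ∫ y : E2, ∫ z : E2,
    f (x + y) * g (x + z) *
      Complex.exp (-(2 * Complex.I) * ((((y 1) * (z 0) - (y 0) * (z 1)) / θ : ℝ) : ℂ))

open scoped FourierTransform ENNReal SchwartzMap ContDiff

theorem lintegral_enorm_fourier_sq_le {V : Type*} [NormedAddCommGroup V] [InnerProductSpace ℝ V]
    [FiniteDimensional ℝ V] [MeasurableSpace V] [BorelSpace V] {f : V → ℂ} (hf : Integrable f) :
    ∫⁻ x, ‖𝓕 f x‖ₑ ^ 2 ≤ ∫⁻ x, ‖f x‖ₑ ^ 2 := by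
  by_cases hfin : ∫⁻ x, ‖f x‖ₑ ^ 2 = ⊤
  · simp [hfin]
  have hL2 : MemLp f 2 := by
    refine ⟨hf.1, ?_⟩
    rw [eLpNorm_lt_top_iff_lintegral_rpow_enorm_lt_top two_ne_zero ENNReal.ofNat_ne_top]
    simpa using lt_top_iff_ne_top.2 hfin
  set F : Lp ℂ 2 (volume : Measure V) := hL2.toLp f with hF
  have hcont : Continuous (𝓕 f) :=
    VectorFourier.fourierIntegral_continuous Real.continuous_fourierChar
      continuous_inner hf
  have hae : ∀ᵐ x, 𝓕 f x = (𝓕 F : Lp ℂ 2 (volume : Measure V)) x := by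
    refine ae_eq_of_integral_contDiff_smul_eq hcont.locallyIntegrable
      ((Lp.memLp _).locallyIntegrable (by norm_num)) fun g hg hgs => ?_
    have hgs' : HasCompactSupport (fun x => (g x : ℂ)) := hgs.comp_left ofReal_zero
    have hg' : ContDiff ℝ ∞ (fun x => (g x : ℂ)) := ofRealCLM.contDiff.comp hg
    set φ : 𝓢(V, ℂ) := hgs'.toSchwartzMap hg' with hφ
    have hφg : ∀ x, φ x = (g x : ℂ) := fun x => rfl
    have key := DFunLike.congr_fun (Lp.fourier_toTemperedDistribution_eq F) φ
    simp only [TemperedDistribution.fourier_apply, Lp.toTemperedDistribution_apply] at key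
    calc ∫ x, g x • 𝓕 f x = ∫ x, φ x • 𝓕 f x := by simp [hφg]
      _ = ∫ x, 𝓕 φ x • f x := by
        simpa using! (VectorFourier.integral_fourierIntegral_smul_eq_flip (L := innerₗ V)
          Real.continuous_fourierChar continuous_inner φ.integrable hf).symm
      _ = ∫ x, 𝓕 φ x • F x := by
        refine integral_congr_ae ?_
        filter_upwards [hL2.coeFn_toLp] with x hx
        rw [hx]
      _ = ∫ x, φ x • (𝓕 F : Lp ℂ 2 (volume : Measure V)) x := key
      _ = _ := by simp [hφg]
  have hsq : ∀ u : V → ℂ, ∫⁻ x, ‖u x‖ₑ ^ 2 = eLpNorm u 2 volume ^ 2 := fun u => by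
    simpa using (eLpNorm_nnreal_pow_eq_lintegral (μ := volume) (f := u) (p := 2) two_ne_zero).symm
  rw [hsq, hsq, eLpNorm_congr_ae hae, ← eLpNorm_congr_ae hL2.coeFn_toLp]
  have h := Lp.norm_fourier_eq F
  rw [← Lp.enorm_def, ← Lp.enorm_def, ← ofReal_norm, ← ofReal_norm, h]

theorem lintegral_comp_mul_left {d : ℝ} (hd : d ≠ 0) (F : ℝ → ℝ≥0∞) :
    ∫⁻ x, F (d * x) = ENNReal.ofReal |d⁻¹| * ∫⁻ x, F x := by
  have h := lintegral_map_equiv (μ := volume) F (Homeomorph.mulLeft₀ d hd).toMeasurableEquiv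
  have hmap : (⇑(Homeomorph.mulLeft₀ d hd).toMeasurableEquiv : ℝ → ℝ) = (d * ·) := rfl
  rw [hmap, Real.map_volume_mul_left hd] at h
  rw [← h, lintegral_smul_measure, smul_eq_mul]

theorem volume_preserving_prodProdProdComm :
    MeasurePreserving (fun w : (ℝ × ℝ) × (ℝ × ℝ) => ((w.1.1, w.2.1), (w.1.2, w.2.2))) := by
  have h1 := volume_preserving_prodAssoc (α₁ := ℝ) (β₁ := ℝ) (γ₁ := ℝ × ℝ)
  have h2 := volume_preserving_prodAssoc (α₁ := ℝ) (β₁ := ℝ) (γ₁ := ℝ)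
  have h3 : MeasurePreserving (Prod.swap : ℝ × ℝ → ℝ × ℝ) := Measure.measurePreserving_swap
  have e := (MeasurePreserving.id (volume : Measure ℝ)).prod
    (h2.comp ((h3.prod (MeasurePreserving.id (volume : Measure ℝ))).comp h2.symm))
  exact (h1.symm.comp (e.comp h1))

/-- The Fourier transform of `f` in its second variable. -/
def partialFourier (f : ℝ × ℝ → ℂ) (w : ℝ × ℝ) : ℂ := 𝓕 (fun p => f (w.1, p)) w.2

theorem measurable_partialFourier {f : ℝ × ℝ → ℂ} (hf : Continuous f) :
    Measurable (partialFourier f) := by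
  unfold partialFourier
  simp_rw [Real.fourier_real_eq]
  have : Continuous fun u : (ℝ × ℝ) × ℝ => Real.fourierChar (-(u.2 * u.1.2)) • f (u.1.1, u.2) :=
    (Real.continuous_fourierChar.comp (by fun_prop)).smul (by fun_prop)
  exact this.stronglyMeasurable.integral_prod_right'.measurable

theorem lintegral_partialFourier_sq_le {f : ℝ × ℝ → ℂ} (hf : Continuous f) (hfi : Integrable f) :
    ∫⁻ t, ∫⁻ s, ‖partialFourier f (t, s)‖ₑ ^ 2 ≤ ∫⁻ w, ‖f w‖ₑ ^ 2 := by
  have hm : Measurable fun w => ‖f w‖ₑ ^ 2 := hf.measurable.enorm.pow_const 2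
  rw [Measure.volume_eq_prod, lintegral_prod _ hm.aemeasurable]
  rw [Measure.volume_eq_prod] at hfi
  refine lintegral_mono_ae ?_
  filter_upwards [hfi.prod_right_ae] with t ht
  exact lintegral_enorm_fourier_sq_le (f := fun p => f (t, p)) ht

theorem lintegral_shear_partialFourier_sq_le {f : ℝ × ℝ → ℂ} (hf : Continuous f)
    (hfi : Integrable f) {d : ℝ} (hd : d ≠ 0) :
    ∫⁻ t, ∫⁻ z, ‖partialFourier f (t + z, d * z)‖ₑ ^ 2 ≤
      ENNReal.ofReal |d⁻¹| * ∫⁻ w, ‖f w‖ₑ ^ 2 := by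
  have hm := measurable_partialFourier hf
  calc ∫⁻ t, ∫⁻ z, ‖partialFourier f (t + z, d * z)‖ₑ ^ 2
      = ∫⁻ z, ∫⁻ t, ‖partialFourier f (t + z, d * z)‖ₑ ^ 2 := lintegral_lintegral_swap (by fun_prop)
    _ = ∫⁻ z, ∫⁻ t, ‖partialFourier f (t, d * z)‖ₑ ^ 2 := by
      congr with z
      exact lintegral_add_right_eq_self (fun t => ‖partialFourier f (t, d * z)‖ₑ ^ 2) z
    _ = ENNReal.ofReal |d⁻¹| * ∫⁻ z, ∫⁻ t, ‖partialFourier f (t, z)‖ₑ ^ 2 :=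
      lintegral_comp_mul_left hd fun z => ∫⁻ t, ‖partialFourier f (t, z)‖ₑ ^ 2
    _ = ENNReal.ofReal |d⁻¹| * ∫⁻ t, ∫⁻ z, ‖partialFourier f (t, z)‖ₑ ^ 2 := by
      rw [lintegral_lintegral_swap (by fun_prop)]
    _ ≤ _ := by gcongr; exact lintegral_partialFourier_sq_le hf hfi

theorem lintegral_mul_sq_le {α : Type*} [MeasurableSpace α] {μ : Measure α} {u v : α → ℝ≥0∞}
    (hu : AEMeasurable u μ) (hv : AEMeasurable v μ) :
    (∫⁻ x, u x * v x ∂μ) ^ 2 ≤ (∫⁻ x, u x ^ 2 ∂μ) * ∫⁻ x, v x ^ 2 ∂μ := by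
  have h := ENNReal.lintegral_mul_le_Lp_mul_Lq μ Real.HolderConjugate.two_two hu hv
  simp only [Pi.mul_apply, ENNReal.rpow_two] at h
  have hs : ∀ t : ℝ≥0∞, (t ^ (1 / 2 : ℝ)) ^ 2 = t := fun t => by
    rw [← ENNReal.rpow_natCast, ← ENNReal.rpow_mul]; norm_num
  calc _ ≤ _ := pow_le_pow_left' h 2
    _ = _ := by rw [mul_pow, hs, hs]

/-- Submultiplicativity of the Hilbert–Schmidt norm, in rotated coordinates. -/
theorem lintegral_rotated_product_sq_le {u v : ℝ × ℝ → ℝ≥0∞} (hu : Measurable u)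
    (hv : Measurable v) :
    ∫⁻ q, ∫⁻ s, (∫⁻ z, u (q + s, z) * v (q - s, s + z)) ^ 2 ≤
      ENNReal.ofReal 2⁻¹ * ((∫⁻ t, ∫⁻ z, u (t, z) ^ 2) * ∫⁻ t, ∫⁻ z, v (t, z) ^ 2) := by
  set α : ℝ → ℝ≥0∞ := fun t => ∫⁻ z, u (t, z) ^ 2 with hα
  set β : ℝ → ℝ≥0∞ := fun t => ∫⁻ z, v (t, z) ^ 2 with hβ
  have hαm : Measurable α := (hu.pow_const 2).lintegral_prod_right'
  have hβm : Measurable β := (hv.pow_const 2).lintegral_prod_right'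
  calc ∫⁻ q, ∫⁻ s, (∫⁻ z, u (q + s, z) * v (q - s, s + z)) ^ 2
      ≤ ∫⁻ q, ∫⁻ s, α (q + s) * β (q - s) := by
        gcongr with q s
        refine (lintegral_mul_sq_le (by fun_prop) (by fun_prop)).trans_eq ?_
        congr 1
        exact lintegral_add_left_eq_self (fun z => v (q - s, z) ^ 2) s
    _ = ∫⁻ s, ∫⁻ q, α (q + s) * β (q - s) := lintegral_lintegral_swap (by fun_prop)
    _ = ∫⁻ s, ∫⁻ q, α (q + 2 * s) * β q := by
        congr with s
        rw [← lintegral_add_right_eq_self _ s]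
        congr with q
        ring_nf
    _ = ∫⁻ q, ∫⁻ s, α (q + 2 * s) * β q := lintegral_lintegral_swap (by fun_prop)
    _ = ∫⁻ q, (ENNReal.ofReal 2⁻¹ * ∫⁻ t, α t) * β q := by
        congr with q
        rw [lintegral_mul_const _ (by fun_prop),
          lintegral_comp_mul_left two_ne_zero fun s => α (q + s), lintegral_add_left_eq_self]
        norm_num
    _ = _ := by rw [lintegral_const_mul _ hβm, mul_assoc]

/-- The integral kernel whose Fourier transform in `s` is a rescaled Moyal product at `(q, ·)`. -/
def moyalKernel (d : ℝ) (f g : ℝ × ℝ → ℂ) (q s : ℝ) : ℂ :=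
  ∫ z, partialFourier f (q + (s + z), d * z) * partialFourier g (q + z, -d * (s + z))

theorem lintegral_moyalKernel_sq_le {f g : ℝ × ℝ → ℂ} (hf : Continuous f) (hfi : Integrable f)
    (hg : Continuous g) (hgi : Integrable g) {d : ℝ} (hd : 0 < d) :
    ∫⁻ q, ∫⁻ s, ‖moyalKernel d f g q s‖ₑ ^ 2 ≤
      ENNReal.ofReal (2⁻¹ * d⁻¹ ^ 2) * ((∫⁻ w, ‖f w‖ₑ ^ 2) * ∫⁻ w, ‖g w‖ₑ ^ 2) := by
  have hfm := measurable_partialFourier hf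
  have hgm := measurable_partialFourier hg
  have key := lintegral_rotated_product_sq_le
    (u := fun w => ‖partialFourier f (w.1 + w.2, d * w.2)‖ₑ)
    (v := fun w => ‖partialFourier g (w.1 + w.2, -d * w.2)‖ₑ) (by fun_prop) (by fun_prop)
  have hF := lintegral_shear_partialFourier_sq_le hf hfi hd.ne'
  have hG := lintegral_shear_partialFourier_sq_le hg hgi (neg_ne_zero.2 hd.ne')
  rw [inv_neg, abs_neg] at hG
  rw [abs_of_pos (inv_pos.2 hd)] at hF hG
  calc _ ≤ _ := by
        refine lintegral_mono fun q => lintegral_mono fun s => pow_le_pow_left' ?_ 2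
        refine (enorm_integral_le_lintegral_enorm _).trans_eq ?_
        congr with z
        rw [enorm_mul, show q + s + z = q + (s + z) by ring,
          show q - s + (s + z) = q + z by ring]
    _ ≤ _ := key
    _ ≤ _ := mul_le_mul_right (mul_le_mul' hF hG) _
    _ = _ := by
        rw [ENNReal.ofReal_mul (by norm_num), ENNReal.ofReal_pow (by positivity)]
        ring

/-- The oscillatory integrand of the Moyal product at `x`, with phase scaled by `d`. -/
def moyalIntegrand (d : ℝ) (f g : ℝ × ℝ → ℂ) (x : ℝ × ℝ) (w : (ℝ × ℝ) × (ℝ × ℝ)) : ℂ :=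
  Real.fourierChar (-(d * (w.1.2 * w.2.1 - w.1.1 * w.2.2))) • (f (x + w.1) * g (x + w.2))

theorem continuous_moyalIntegrand {d : ℝ} {f g : ℝ × ℝ → ℂ} (hf : Continuous f)
    (hg : Continuous g) (x : ℝ × ℝ) : Continuous (moyalIntegrand d f g x) :=
  (Real.continuous_fourierChar.comp (by fun_prop)).smul (by fun_prop)

theorem integrable_moyalIntegrand {d : ℝ} {f g : ℝ × ℝ → ℂ} (hf : Continuous f)
    (hfi : Integrable f) (hg : Continuous g) (hgi : Integrable g) (x : ℝ × ℝ) :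
    Integrable (moyalIntegrand d f g x) := by
  have h := (hfi.comp_add_left x).mul_prod (hgi.comp_add_left x)
  rw [← Measure.volume_eq_prod] at h
  refine h.mono (continuous_moyalIntegrand hf hg x).aestronglyMeasurable (.of_forall fun w => ?_)
  rw [moyalIntegrand, Circle.norm_smul]

theorem integral_moyalIntegrand_comm (d : ℝ) (f g : ℝ × ℝ → ℂ) (q p : ℝ) (w : ℝ × ℝ) :
    ∫ v : ℝ × ℝ, moyalIntegrand d f g (q, p) ((w.1, v.1), (w.2, v.2)) =
      Real.fourierChar (-(d * (p * (w.1 - w.2)))) •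
        (partialFourier f (q + w.1, d * w.2) * partialFourier g (q + w.2, -d * w.1)) := by
  simp only [partialFourier, Real.fourier_real_eq]
  rw [Measure.volume_eq_prod, ← integral_prod_mul, ← Measure.volume_eq_prod, Circle.smul_def,
    ← integral_smul]
  conv_rhs => rw [← integral_add_left_eq_self _ (p, p)]
  congr with v
  have hphase : (Real.fourierChar (-(d * (v.1 * w.2 - w.1 * v.2))) : ℂ) =
      Real.fourierChar (-(d * (p * (w.1 - w.2)))) *
        (Real.fourierChar (-((p + v.1) * (d * w.2))) *
          Real.fourierChar (-((p + v.2) * (-d * w.1)))) := by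
    rw [← Circle.coe_mul, ← Circle.coe_mul, ← AddChar.map_add_eq_mul, ← AddChar.map_add_eq_mul]
    congr 2
    ring
  simp only [moyalIntegrand, Circle.smul_def, smul_eq_mul, Prod.fst_add, Prod.snd_add,
    Prod.mk_add_mk, hphase]
  ring

theorem integrable_and_integral_moyalIntegrand_eq {d : ℝ} {f g : ℝ × ℝ → ℂ}
    (hf : Continuous f) (hfi : Integrable f) (hg : Continuous g) (hgi : Integrable g)
    (q p : ℝ) :
    Integrable (fun s => Real.fourierChar (-(d * (p * s))) • moyalKernel d f g q s) ∧
      ∫ w, moyalIntegrand d f g (q, p) w =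
        ∫ s, Real.fourierChar (-(d * (p * s))) • moyalKernel d f g q s := by
  have hΦ := integrable_moyalIntegrand (d := d) hf hfi hg hgi (q, p)
  have hcomm := volume_preserving_prodProdProdComm
  have hshear : MeasurePreserving (fun w : ℝ × ℝ => (w.1 + w.2, w.2)) :=
    measurePreserving_add_prod volume volume
  have hΨ := hcomm.integrable_comp_of_integrable hΦ
  have hH : Integrable fun w : ℝ × ℝ =>
      ∫ v : ℝ × ℝ, moyalIntegrand d f g (q, p) ((w.1, v.1), (w.2, v.2)) :=
    hΨ.integral_prod_left
  have hK := hshear.integrable_comp_of_integrable hH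
  have hinner : ∀ s, ∫ z, ∫ v : ℝ × ℝ,
      moyalIntegrand d f g (q, p) ((s + z, v.1), (z, v.2)) =
        Real.fourierChar (-(d * (p * s))) • moyalKernel d f g q s := fun s => by
    rw [moyalKernel, Circle.smul_def, ← integral_smul]
    congr with z
    have := integral_moyalIntegrand_comm d f g q p (s + z, z)
    simpa [Circle.smul_def] using this
  have hfub : ∫ w, moyalIntegrand d f g (q, p) w = ∫ s, ∫ z, ∫ v : ℝ × ℝ,
      moyalIntegrand d f g (q, p) ((s + z, v.1), (z, v.2)) := by
    calc _ = ∫ w : (ℝ × ℝ) × (ℝ × ℝ),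
          moyalIntegrand d f g (q, p) ((w.1.1, w.2.1), (w.1.2, w.2.2)) := by
          have h := integral_map hcomm.measurable.aemeasurable (by rw [hcomm.map_eq]; exact hΦ.1)
          rwa [hcomm.map_eq] at h
      _ = ∫ w : ℝ × ℝ, ∫ v : ℝ × ℝ,
          moyalIntegrand d f g (q, p) ((w.1, v.1), (w.2, v.2)) := integral_prod _ hΨ
      _ = ∫ w : ℝ × ℝ, ∫ v : ℝ × ℝ,
          moyalIntegrand d f g (q, p) ((w.1 + w.2, v.1), (w.2, v.2)) := by
          have h := integral_map hshear.measurable.aemeasurable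
            (by rw [hshear.map_eq]; exact hH.1)
          rwa [hshear.map_eq] at h
      _ = _ := integral_prod _ hK
  refine ⟨?_, by simp_rw [hfub, hinner]⟩
  simpa only [Function.comp_def, hinner] using Integrable.integral_prod_left hK

theorem lintegral_integral_moyalIntegrand_sq_le {d : ℝ} (hd : 0 < d) {f g : ℝ × ℝ → ℂ}
    (hf : Continuous f) (hfi : Integrable f) (hg : Continuous g) (hgi : Integrable g) :
    ∫⁻ x, ‖∫ w, moyalIntegrand d f g x w‖ₑ ^ 2 ≤
      ENNReal.ofReal (2⁻¹ * d⁻¹ ^ 3) * ((∫⁻ w, ‖f w‖ₑ ^ 2) * ∫⁻ w, ‖g w‖ₑ ^ 2) := by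
  have hrep : ∀ q p, ∫ w, moyalIntegrand d f g (q, p) w =
      d⁻¹ • 𝓕 (fun σ => moyalKernel d f g q (d⁻¹ * σ)) p := fun q p => by
    rw [(integrable_and_integral_moyalIntegrand_eq hf hfi hg hgi q p).2, Real.fourier_real_eq]
    have h := Measure.integral_comp_mul_left
      (fun s => Real.fourierChar (-(d * (p * s))) • moyalKernel d f g q s) d⁻¹
    rw [inv_inv, abs_of_pos hd] at h
    rw [← inv_smul_eq_iff₀ (inv_ne_zero hd.ne'), inv_inv, ← h]
    congr with σ
    congr 3
    field_simp
  have hint : ∀ q, Integrable fun σ => moyalKernel d f g q (d⁻¹ * σ) := fun q => by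
    have h := (integrable_and_integral_moyalIntegrand_eq (d := d) hf hfi hg hgi q 0).1
    simp only [zero_mul, mul_zero, neg_zero, AddChar.map_zero_eq_one, one_smul] at h
    exact h.comp_mul_left' (inv_ne_zero hd.ne')
  calc ∫⁻ x, ‖∫ w, moyalIntegrand d f g x w‖ₑ ^ 2
      ≤ ∫⁻ q, ∫⁻ p, ‖∫ w, moyalIntegrand d f g (q, p) w‖ₑ ^ 2 := lintegral_prod_le _
    _ = ∫⁻ q, ENNReal.ofReal (d⁻¹ ^ 2) *
          ∫⁻ p, ‖𝓕 (fun σ => moyalKernel d f g q (d⁻¹ * σ)) p‖ₑ ^ 2 := by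
        congr with q
        rw [← lintegral_const_mul' _ _ ENNReal.ofReal_ne_top]
        congr with p
        rw [hrep, enorm_smul, mul_pow, Real.enorm_of_nonneg (by positivity),
          ENNReal.ofReal_pow (by positivity)]
    _ ≤ ∫⁻ q, ENNReal.ofReal (d⁻¹ ^ 2) * ∫⁻ σ, ‖moyalKernel d f g q (d⁻¹ * σ)‖ₑ ^ 2 := by
        gcongr ∫⁻ q, _ * ?_ with q
        exact lintegral_enorm_fourier_sq_le (hint q)
    _ = ∫⁻ q, ENNReal.ofReal d⁻¹ * ∫⁻ s, ‖moyalKernel d f g q s‖ₑ ^ 2 := by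
        congr with q
        rw [lintegral_comp_mul_left (inv_ne_zero hd.ne') fun s => ‖moyalKernel d f g q s‖ₑ ^ 2,
          ← mul_assoc, ← ENNReal.ofReal_mul (by positivity), inv_inv, abs_of_pos hd]
        congr 2
        field_simp
    _ = ENNReal.ofReal d⁻¹ * ∫⁻ q, ∫⁻ s, ‖moyalKernel d f g q s‖ₑ ^ 2 :=
        lintegral_const_mul' _ _ ENNReal.ofReal_ne_top
    _ ≤ _ := mul_le_mul_right (lintegral_moyalKernel_sq_le hf hfi hg hgi hd) _
    _ = _ := by
        rw [← mul_assoc, ← ENNReal.ofReal_mul (by positivity)]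
        congr 2
        ring

/-- The identification of `E2` with `ℝ × ℝ` by coordinates. -/
def E2.equivProd : E2 ≃ᵐ ℝ × ℝ :=
  (MeasurableEquiv.toLp 2 (Fin 2 → ℝ)).symm.trans MeasurableEquiv.finTwoArrow

theorem E2.equivProd_apply (x : E2) : E2.equivProd x = (x 0, x 1) := rfl

theorem E2.equivProd_add (x y : E2) :
    E2.equivProd (x + y) = E2.equivProd x + E2.equivProd y := rfl

theorem E2.volume_preserving_equivProd : MeasurePreserving E2.equivProd :=
  (volume_preserving_finTwoArrow ℝ).comp
    (EuclideanSpace.volume_preserving_symm_measurableEquiv_toLp (Fin 2))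

theorem E2.continuous_equivProd_symm : Continuous E2.equivProd.symm := by
  have : (E2.equivProd.symm : ℝ × ℝ → E2) = fun w => !₂[w.1, w.2] := by
    funext w
    rw [MeasurableEquiv.symm_apply_eq]
    simp [E2.equivProd_apply]
  rw [this]
  fun_prop

theorem moyal_eq_integral_moyalIntegrand (θ : ℝ) (f g : E2 → ℂ) (hf : Continuous f)
    (hfi : Integrable f) (hg : Continuous g) (hgi : Integrable g) (x : E2) :
    moyal θ f g x = (((Real.pi * θ) ^ 2)⁻¹ : ℝ) • ∫ w,
      moyalIntegrand (Real.pi * θ)⁻¹ (f ∘ E2.equivProd.symm) (g ∘ E2.equivProd.symm)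
        (E2.equivProd x) w := by
  have hs := E2.volume_preserving_equivProd.symm
  have hc := E2.continuous_equivProd_symm
  rw [Measure.volume_eq_prod, integral_prod _ (integrable_moyalIntegrand (hf.comp hc)
    (hs.integrable_comp_of_integrable hfi) (hg.comp hc) (hs.integrable_comp_of_integrable hgi) _),
    ← E2.volume_preserving_equivProd.integral_comp']
  simp_rw [← E2.volume_preserving_equivProd.integral_comp'
    (g := fun z => moyalIntegrand _ _ _ _ (_, z))]
  simp only [moyal]
  congr! with y z
  rw [moyalIntegrand, Circle.smul_def, Real.fourierChar_apply, smul_eq_mul, mul_comm]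
  simp only [Function.comp_apply, ← E2.equivProd_add, MeasurableEquiv.symm_apply_apply]
  congr 2
  simp only [E2.equivProd_apply]
  have := Real.pi_ne_zero
  push_cast
  field_simp

theorem lintegral_moyal_sq_le {θ : ℝ} (hθ : 0 < θ) {f g : E2 → ℂ} (hf : Continuous f)
    (hfi : Integrable f) (hg : Continuous g) (hgi : Integrable g) :
    ∫⁻ x, ‖moyal θ f g x‖ₑ ^ 2 ≤
      ENNReal.ofReal (2 * Real.pi * θ)⁻¹ * ((∫⁻ x, ‖f x‖ₑ ^ 2) * ∫⁻ x, ‖g x‖ₑ ^ 2) := by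
  have he := E2.volume_preserving_equivProd
  have hc := E2.continuous_equivProd_symm
  have hd : 0 < (Real.pi * θ)⁻¹ := by positivity
  have key := lintegral_integral_moyalIntegrand_sq_le hd (hf.comp hc)
    (he.symm.integrable_comp_of_integrable hfi) (hg.comp hc)
    (he.symm.integrable_comp_of_integrable hgi)
  have hsymm : ∀ u : E2 → ℂ, ∫⁻ w, ‖(u ∘ E2.equivProd.symm) w‖ₑ ^ 2 = ∫⁻ x, ‖u x‖ₑ ^ 2 :=
    fun u => he.symm.lintegral_comp_emb E2.equivProd.symm.measurableEmbedding (fun x => ‖u x‖ₑ ^ 2)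
  rw [hsymm, hsymm, ← he.lintegral_comp_emb E2.equivProd.measurableEmbedding] at key
  simp_rw [moyal_eq_integral_moyalIntegrand θ f g hf hfi hg hgi, enorm_smul, mul_pow]
  rw [lintegral_const_mul' _ _ (ENNReal.pow_ne_top enorm_ne_top)]
  refine (mul_le_mul_right key _).trans_eq ?_
  rw [Real.enorm_of_nonneg (by positivity), ← ENNReal.ofReal_pow (by positivity), ← mul_assoc,
    ← ENNReal.ofReal_mul (by positivity)]
  congr 2
  have := Real.pi_pos
  field_simp

/-- The L² estimate for the Moyal product:
`‖a ⋆ b‖₂ ≤ (2πθ)^{-1/2} ‖a‖₂ ‖b‖₂`. -/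
theorem moyal_l2_estimate (θ : ℝ) (hθ : 0 < θ) (a b : SchwartzMap E2 ℂ) :
    Real.sqrt (∫ x : E2, ‖moyal θ (⇑a) (⇑b) x‖ ^ 2)
      ≤ (Real.sqrt (2 * Real.pi * θ))⁻¹ *
        (Real.sqrt (∫ x : E2, ‖a x‖ ^ 2) * Real.sqrt (∫ x : E2, ‖b x‖ ^ 2)) := by
  have key := lintegral_moyal_sq_le hθ a.continuous a.integrable b.continuous b.integrable
  have hS : ∀ u : SchwartzMap E2 ℂ,
      ∫⁻ x, ‖u x‖ₑ ^ 2 = ENNReal.ofReal (∫ x, ‖u x‖ ^ 2) := fun u => by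
    rw [ofReal_integral_eq_lintegral_ofReal
      (by simpa using (u.memLp 2).integrable_norm_pow two_ne_zero)
      (.of_forall fun x => by positivity)]
    simp_rw [← ofReal_norm, ENNReal.ofReal_pow (norm_nonneg _)]
  have hle : ENNReal.ofReal (∫ x, ‖moyal θ a b x‖ ^ 2) ≤ ∫⁻ x, ‖moyal θ a b x‖ₑ ^ 2 := by
    refine (ENNReal.ofReal_le_ofReal (le_abs_self _)).trans ?_
    rw [← Real.norm_eq_abs, ofReal_norm]
    refine (enorm_integral_le_lintegral_enorm _).trans_eq ?_
    simp
  rw [hS, hS, ← ENNReal.ofReal_mul (by positivity), ← ENNReal.ofReal_mul (by positivity)] at key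
  rw [← Real.sqrt_inv, ← Real.sqrt_mul (by positivity), ← Real.sqrt_mul (by positivity)]
  exact Real.sqrt_le_sqrt ((ENNReal.ofReal_le_ofReal_iff (by positivity)).1 (hle.trans key))

end
end

section
/- Fix θ > 0 and ξ ∈ ℝ, and define the operator 𝒟_ξ on Schwartz functions Ψ : ℝ² → ℂ² by 𝒟_ξ Ψ := Σ_{μ=1,2} σ^μ(−i ∂_μ Ψ) + ξ σ^μ (x̃_μ·Ψ). Then for every Schwartz a : ℝ² → ℂ and every Schwartz Ψ : ℝ² → ℂ², the commutator of 𝒟_ξ with left Moyal multiplication by a is 𝒟_ξ(a ⋆ Ψ) − a ⋆ (𝒟_ξ Ψ) = (1−ξ) Σ_{μ=1,2} σ^μ((−i ∂_μ a) ⋆ Ψ), where a ⋆ Ψ is taken componentwise. In particular, for ξ = 1 this commutator vanishes identically. -/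
open MeasureTheory Complex

noncomputable section

/-- Componentwise Moyal product of a scalar function with a vector-valued function. -/
def moyalV {n : Type*} (θ : ℝ) (a : E2 → ℂ) (Ψ : E2 → n → ℂ) : E2 → n → ℂ :=
  fun x i => moyal θ a (fun y => Ψ y i) x

/-- Partial derivative in the μ-th coordinate direction. -/
def pd {V : Type*} [NormedAddCommGroup V] [NormedSpace ℝ V] (μ : Fin 2) (f : E2 → V) :
    E2 → V := fun x => fderiv ℝ f x (EuclideanSpace.single μ (1 : ℝ))

/-- The coordinate functions `x̃₁(x) = −2x₂/θ` and `x̃₂(x) = 2x₁/θ`. -/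
def xt (θ : ℝ) : Fin 2 → E2 → ℝ := ![fun x => -2 * x 1 / θ, fun x => 2 * x 0 / θ]

/-- The Pauli matrices σ¹, σ². -/
def σv : Fin 2 → Matrix (Fin 2) (Fin 2) ℂ :=
  ![!![0, 1; 1, 0], !![0, Complex.I; -Complex.I, 0]]

/-- The Landau-type Dirac operator `𝒟_ξ Ψ = Σ_μ σ^μ(−i∂_μΨ) + ξσ^μ(x̃_μ·Ψ)`. -/
def Dxi (θ ξ : ℝ) (Ψ : E2 → Fin 2 → ℂ) : E2 → Fin 2 → ℂ := fun x =>
  ∑ μ : Fin 2, ((σv μ).mulVec ((-Complex.I) • pd μ Ψ x)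
    + ξ • (σv μ).mulVec (xt θ μ x • Ψ x))

/-- The oscillating kernel of the Moyal product. -/
def moyalPhase (θ : ℝ) (y z : E2) : ℂ :=
  Complex.exp (-(2 * Complex.I) * ((((y 1) * (z 0) - (y 0) * (z 1)) / θ : ℝ) : ℂ))

lemma norm_moyalPhase (θ : ℝ) (y z : E2) : ‖moyalPhase θ y z‖ = 1 := by
  rw [moyalPhase, Complex.norm_exp]
  simp

lemma continuous_moyalPhase (θ : ℝ) :
    Continuous fun p : E2 × E2 => moyalPhase θ p.1 p.2 := by
  unfold moyalPhase
  fun_prop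

lemma integrable_moyal_integrand (θ : ℝ) {f g : E2 → ℂ} (hf : Integrable f) (hg : Integrable g)
    (x : E2) :
    Integrable (fun p : E2 × E2 => f (x + p.1) * g (x + p.2) * moyalPhase θ p.1 p.2)
      (volume.prod volume) :=
  ((hf.comp_add_left x).mul_prod (hg.comp_add_left x)).mul_bdd (c := 1)
    (continuous_moyalPhase θ).aestronglyMeasurable
    (ae_of_all _ fun p => (norm_moyalPhase θ p.1 p.2).le)

lemma moyal_eq_integral_prod (θ : ℝ) {f g : E2 → ℂ} (hf : Integrable f) (hg : Integrable g)
    (x : E2) :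
    moyal θ f g x = (((Real.pi * θ) ^ 2)⁻¹ : ℝ) •
      ∫ p : E2 × E2, f (x + p.1) * g (x + p.2) * moyalPhase θ p.1 p.2 ∂(volume.prod volume) := by
  rw [integral_prod _ (integrable_moyal_integrand θ hf hg x)]
  rfl

lemma moyal_eq_integral_swap (θ : ℝ) {f g : E2 → ℂ} (hf : Integrable f) (hg : Integrable g)
    (x : E2) :
    moyal θ f g x = (((Real.pi * θ) ^ 2)⁻¹ : ℝ) •
      ∫ z : E2, ∫ y : E2, f (x + y) * g (x + z) * moyalPhase θ y z := by
  rw [moyal_eq_integral_prod θ hf hg, integral_prod_symm _ (integrable_moyal_integrand θ hf hg x)]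

lemma moyal_const_mul_left (θ : ℝ) (c : ℂ) (f g : E2 → ℂ) (x : E2) :
    moyal θ (fun y => c * f y) g x = c * moyal θ f g x := by
  simp only [moyal, mul_assoc, integral_const_mul, mul_smul_comm]

lemma moyal_const_mul_right (θ : ℝ) (c : ℂ) (f g : E2 → ℂ) (x : E2) :
    moyal θ f (fun y => c * g y) x = c * moyal θ f g x := by
  simp only [moyal, mul_assoc, mul_left_comm _ c, integral_const_mul, mul_smul_comm]

lemma moyal_add_right (θ : ℝ) {f g h : E2 → ℂ} (hf : Integrable f) (hg : Integrable g)
    (hh : Integrable h) (x : E2) :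
    moyal θ f (fun y => g y + h y) x = moyal θ f g x + moyal θ f h x := by
  rw [moyal_eq_integral_prod θ hf hg, moyal_eq_integral_prod θ hf hh,
    moyal_eq_integral_prod θ hf (g := fun y => g y + h y) (hg.add hh), ← smul_add,
    ← integral_add (integrable_moyal_integrand θ hf hg x) (integrable_moyal_integrand θ hf hh x)]
  simp only [mul_add, add_mul]

lemma moyal_sum_right {ι : Type*} (s : Finset ι) (θ : ℝ) {f : E2 → ℂ} {g : ι → E2 → ℂ}
    (hf : Integrable f) (hg : ∀ i ∈ s, Integrable (g i)) (x : E2) :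
    moyal θ f (fun y => ∑ i ∈ s, g i y) x = ∑ i ∈ s, moyal θ f (g i) x := by
  classical
  induction s using Finset.induction_on with
  | empty => simp [moyal]
  | insert i s hi ih =>
    have hs : ∀ j ∈ s, Integrable (g j) := fun j hj => hg j (Finset.mem_insert_of_mem hj)
    simp only [Finset.sum_insert hi]
    rw [moyal_add_right θ hf (hg i (Finset.mem_insert_self i s)) (integrable_finsetSum s hs), ih hs]

/-- The partial derivative of a Schwartz function, as a Schwartz function. -/
def schwartzPd (μ : Fin 2) (f : SchwartzMap E2 ℂ) : SchwartzMap E2 ℂ :=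
  (SchwartzMap.fderivCLM ℝ E2 ℂ f).postcompCLM
    (ContinuousLinearMap.apply ℝ ℂ (EuclideanSpace.single μ (1 : ℝ)))

lemma coe_schwartzPd (μ : Fin 2) (f : SchwartzMap E2 ℂ) : ⇑(schwartzPd μ f) = pd μ ⇑f := rfl

lemma integrable_pd (μ : Fin 2) (f : SchwartzMap E2 ℂ) : Integrable (pd μ ⇑f) :=
  coe_schwartzPd μ f ▸ (schwartzPd μ f).integrable

lemma hasTemperateGrowth_xt (θ : ℝ) (μ : Fin 2) : (xt θ μ).HasTemperateGrowth := by
  have h (i : Fin 2) : (fun x : E2 => x i).HasTemperateGrowth :=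
    (EuclideanSpace.proj i : E2 →L[ℝ] ℝ).hasTemperateGrowth
  have h0 := h 0
  have h1 := h 1
  fin_cases μ <;> simp only [xt, div_eq_mul_inv] <;> simp <;> fun_prop

lemma integrable_xt_mul (θ : ℝ) (μ : Fin 2) (f : SchwartzMap E2 ℂ) :
    Integrable fun y => (xt θ μ y : ℂ) * f y := by
  have h := (SchwartzMap.smulLeftCLM ℂ (xt θ μ) f).integrable (μ := volume)
  rw [SchwartzMap.smulLeftCLM_apply (hasTemperateGrowth_xt θ μ)] at h
  simpa only [Complex.real_smul] using h

lemma xt_add (θ : ℝ) (μ : Fin 2) (x y : E2) : xt θ μ (x + y) = xt θ μ x + xt θ μ y := by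
  fin_cases μ <;> simp [xt] <;> ring

lemma hasFDerivAt_moyalPhase (θ : ℝ) (y z : E2) :
    ∃ L : E2 →L[ℝ] ℂ, HasFDerivAt (fun y => moyalPhase θ y z) L y ∧
      ∀ μ : Fin 2, L (EuclideanSpace.single μ 1) = -I * xt θ μ z * moyalPhase θ y z := by
  let p (i : Fin 2) : E2 →L[ℝ] ℝ := EuclideanSpace.proj i
  let l : E2 →L[ℝ] ℂ := Complex.ofRealCLM.comp (θ⁻¹ • (z 0 • p 1 - z 1 • p 0))
  have hl (y : E2) : -(2 * I) * ((((y 1) * (z 0) - (y 0) * (z 1)) / θ : ℝ) : ℂ)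
      = (-(2 * I) • l) y := by
    simp [l, p]; ring
  have hph : (fun y => moyalPhase θ y z) = fun y => Complex.exp ((-(2 * I) • l) y) :=
    funext fun y => congrArg Complex.exp (hl y)
  refine ⟨moyalPhase θ y z • (-(2 * I) • l), ?_, fun μ => ?_⟩
  · rw [moyalPhase, hl, hph]
    exact (-(2 * I) • l).hasFDerivAt.cexp
  · fin_cases μ <;> simp [l, p, xt] <;> ring

/-- Integration by parts against the kernel of the Moyal product. -/
lemma integral_mul_xt_mul_moyalPhase (θ : ℝ) (μ : Fin 2) (a : SchwartzMap E2 ℂ) (x z : E2) :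
    ∫ y, a (x + y) * xt θ μ z * moyalPhase θ y z
      = -I * ∫ y, pd μ a (x + y) * moyalPhase θ y z := by
  choose L hL hLμ using fun y => hasFDerivAt_moyalPhase θ y z
  have hcont : Continuous fun y => moyalPhase θ y z :=
    continuous_iff_continuousAt.2 fun y => (hL y).continuousAt
  have hint {f : E2 → ℂ} (hf : Integrable f) :
      Integrable fun y => f (x + y) * moyalPhase θ y z :=
    (hf.comp_add_left x).mul_bdd (c := 1) hcont.aestronglyMeasurable
      (ae_of_all _ fun y => (norm_moyalPhase θ y z).le)
  have hda (y : E2) : fderiv ℝ (fun y => a (x + y)) y = fderiv ℝ a (x + y) :=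
    fderiv_comp_add_left x
  have key := integral_mul_fderiv_eq_neg_fderiv_mul_of_integrable (μ := volume) (𝕜 := ℂ)
    (f := fun y => a (x + y)) (g := fun y => moyalPhase θ y z)
    (v := EuclideanSpace.single μ (1 : ℝ)) ?_ ?_ (hint a.integrable)
    (fun y _ => (a.differentiableAt.comp y (by fun_prop)))
    (fun y _ => (hL y).differentiableAt)
  · simp only [hda, (hL _).fderiv, hLμ] at key
    have h1 : ∀ y, a (x + y) * (-I * xt θ μ z * moyalPhase θ y z)
        = -I * (a (x + y) * xt θ μ z * moyalPhase θ y z) := fun y => by ring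
    simp only [h1, integral_const_mul] at key
    have h2 := congrArg (I * ·) key
    simp only [pd]
    linear_combination h2 + (∫ y, a (x + y) * xt θ μ z * moyalPhase θ y z) * I_mul_I
  · simp only [hda]
    exact hint (integrable_pd μ a)
  · simp only [(hL _).fderiv, hLμ]
    refine ((hint a.integrable).const_mul (-I * xt θ μ z)).congr (ae_of_all _ fun y => ?_)
    simp only
    ring

lemma moyal_xt_mul_right (θ : ℝ) (μ : Fin 2) (a g : SchwartzMap E2 ℂ) (x : E2) :
    moyal θ a (fun y => (xt θ μ y : ℂ) * g y) x
      = xt θ μ x * moyal θ a g x - I * moyal θ (pd μ a) g x := by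
  have ha : Integrable a := a.integrable
  have hg : Integrable g := g.integrable
  have hi₁ := (integrable_moyal_integrand θ ha hg x)
  have hi₂ := (integrable_moyal_integrand θ (integrable_pd μ a) hg x)
  rw [moyal_eq_integral_swap θ ha (integrable_xt_mul θ μ g), moyal_eq_integral_swap θ ha hg,
    moyal_eq_integral_swap θ (integrable_pd μ a) hg, mul_smul_comm, mul_smul_comm, ← smul_sub,
    ← integral_const_mul, ← integral_const_mul,
    ← integral_sub (hi₁.integral_prod_right.const_mul _) (hi₂.integral_prod_right.const_mul _)]
  congr 1
  refine integral_congr_ae ?_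
  filter_upwards [hi₁.prod_left_ae] with z hz
  have hph : Continuous fun y => moyalPhase θ y z :=
    (continuous_moyalPhase θ).comp (by fun_prop : Continuous fun y : E2 => (y, z))
  have haph : Integrable fun y => a (x + y) * moyalPhase θ y z :=
    (ha.comp_add_left x).mul_bdd (c := 1) hph.aestronglyMeasurable
      (ae_of_all _ fun y => (norm_moyalPhase θ y z).le)
  have h1 : ∀ y, a (x + y) * ((xt θ μ (x + z) : ℂ) * g (x + z)) * moyalPhase θ y z
      = xt θ μ x * (a (x + y) * g (x + z) * moyalPhase θ y z)
        + g (x + z) * (a (x + y) * xt θ μ z * moyalPhase θ y z) := fun y => by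
    rw [xt_add]; push_cast; ring
  have h2 : ∀ y, pd μ a (x + y) * g (x + z) * moyalPhase θ y z
      = g (x + z) * (pd μ a (x + y) * moyalPhase θ y z) := fun y => by ring
  simp only [h1, h2]
  rw [integral_add (hz.const_mul _), integral_const_mul, integral_const_mul, integral_const_mul,
    integral_mul_xt_mul_moyalPhase]
  · ring
  · refine (haph.const_mul (g (x + z) * xt θ μ z)).congr (ae_of_all _ fun y => ?_)
    simp only
    ring

/-- Translates of a Schwartz function by vectors near `x₀` have a common integrable bound. -/
lemma exists_integrable_bound_translate {V : Type*} [NormedAddCommGroup V] [NormedSpace ℝ V]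
    (f : SchwartzMap E2 V) (x₀ : E2) :
    ∃ B : E2 → ℝ, Integrable B ∧ ∀ x ∈ Metric.ball x₀ 1, ∀ y, ‖f (x + y)‖ ≤ B y := by
  set C := 2 ^ 3 * (Finset.Iic (3, 0)).sup (fun m => SchwartzMap.seminorm ℝ m.1 m.2) f
  have hC (y : E2) : (1 + ‖y‖) ^ 3 * ‖f y‖ ≤ C := by
    simpa using SchwartzMap.one_add_le_sup_seminorm_apply (𝕜 := ℝ) (m := (3, 0)) (k := 3) (n := 0)
      le_rfl le_rfl f y
  have hint : Integrable fun y : E2 => (1 + ‖y‖) ^ (-3 : ℝ) :=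
    integrable_one_add_norm (by simp; norm_num)
  refine ⟨fun y => 2 ^ 3 * C * (1 + ‖x₀ + y‖) ^ (-3 : ℝ),
    (hint.comp_add_left x₀).const_mul _, fun x hx y => ?_⟩
  have h1 : ‖x₀ + y‖ ≤ 1 + ‖x + y‖ := by
    have : x₀ + y = (x₀ - x) + (x + y) := by abel
    have hx' : ‖x₀ - x‖ < 1 := by rwa [← dist_eq_norm, dist_comm]
    rw [this]
    linarith [norm_add_le (x₀ - x) (x + y)]
  have h2 : (1 + ‖x₀ + y‖) ^ 3 ≤ 2 ^ 3 * (1 + ‖x + y‖) ^ 3 := by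
    rw [← mul_pow]
    gcongr
    linarith [norm_nonneg (x + y)]
  have h3 : (1 + ‖x₀ + y‖) ^ (-3 : ℝ) = ((1 + ‖x₀ + y‖) ^ 3)⁻¹ := by
    rw [Real.rpow_neg (by positivity)]
    norm_cast
  simp only
  rw [h3, ← div_eq_mul_inv, le_div_iff₀ (by positivity)]
  calc ‖f (x + y)‖ * (1 + ‖x₀ + y‖) ^ 3 ≤ ‖f (x + y)‖ * (2 ^ 3 * (1 + ‖x + y‖) ^ 3) := by gcongr
    _ = 2 ^ 3 * ((1 + ‖x + y‖) ^ 3 * ‖f (x + y)‖) := by ring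
    _ ≤ 2 ^ 3 * C := by gcongr; exact hC _

lemma hasFDerivAt_moyal (θ : ℝ) (a g : SchwartzMap E2 ℂ) (x : E2) :
    ∃ L : E2 →L[ℝ] ℂ, HasFDerivAt (moyal θ a g) L x ∧
      ∀ μ : Fin 2, L (EuclideanSpace.single μ 1)
        = moyal θ (pd μ a) g x + moyal θ a (pd μ g) x := by
  have ha : Integrable a := a.integrable
  have hg : Integrable g := g.integrable
  let F' : E2 → E2 × E2 → E2 →L[ℝ] ℂ := fun x p =>
    moyalPhase θ p.1 p.2 • (a (x + p.1) • fderiv ℝ g (x + p.2) + g (x + p.2) • fderiv ℝ a (x + p.1))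
  obtain ⟨Ba, hBa, hBa'⟩ := exists_integrable_bound_translate a x
  obtain ⟨Bg, hBg, hBg'⟩ := exists_integrable_bound_translate g x
  obtain ⟨Da, hDa, hDa'⟩ := exists_integrable_bound_translate (SchwartzMap.fderivCLM ℝ E2 ℂ a) x
  obtain ⟨Dg, hDg, hDg'⟩ := exists_integrable_bound_translate (SchwartzMap.fderivCLM ℝ E2 ℂ g) x
  simp only [SchwartzMap.fderivCLM_apply] at hDa' hDg'
  have hbound : Integrable (fun p : E2 × E2 => Ba p.1 * Dg p.2 + Da p.1 * Bg p.2)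
      (volume.prod volume) := (hBa.mul_prod hDg).add (hDa.mul_prod hBg)
  have hle : ∀ p, ∀ x' ∈ Metric.ball x 1, ‖F' x' p‖ ≤ Ba p.1 * Dg p.2 + Da p.1 * Bg p.2 := by
    intro p x' hx'
    rw [norm_smul, norm_moyalPhase, one_mul, mul_comm (Da _)]
    refine (norm_add_le _ _).trans (add_le_add ?_ ?_) <;> rw [norm_smul]
    · exact mul_le_mul (hBa' _ hx' _) (hDg' _ hx' _) (norm_nonneg _)
        ((norm_nonneg _).trans (hBa' _ hx' p.1))
    · exact mul_le_mul (hBg' _ hx' _) (hDa' _ hx' _) (norm_nonneg _)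
        ((norm_nonneg _).trans (hBg' _ hx' p.2))
  have hcont : Continuous (F' x) := by
    have h1 := continuous_moyalPhase θ
    have h2 := (SchwartzMap.fderivCLM ℝ E2 ℂ a).continuous
    have h3 := (SchwartzMap.fderivCLM ℝ E2 ℂ g).continuous
    have h4 : Continuous fun p : E2 × E2 => fderiv ℝ a (x + p.1) := h2.comp (by fun_prop)
    have h5 : Continuous fun p : E2 × E2 => fderiv ℝ g (x + p.2) := h3.comp (by fun_prop)
    have h6 := a.continuous
    have h7 := g.continuous
    fun_prop
  have hF'int : Integrable (F' x) (volume.prod volume) :=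
    hbound.mono' hcont.aestronglyMeasurable
      (ae_of_all _ fun p => hle p x (Metric.mem_ball_self one_pos))
  have hdiff : ∀ p : E2 × E2, ∀ x' ∈ Metric.ball x 1,
      HasFDerivAt (fun x => a (x + p.1) * g (x + p.2) * moyalPhase θ p.1 p.2) (F' x' p) x' := by
    intro p x' _
    have h1 : HasFDerivAt (fun x => a (x + p.1)) (fderiv ℝ a (x' + p.1)) x' :=
      (hasFDerivAt_comp_add_right p.1).2 (a.hasFDerivAt (x' + p.1))
    have h2 : HasFDerivAt (fun x => g (x + p.2)) (fderiv ℝ g (x' + p.2)) x' :=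
      (hasFDerivAt_comp_add_right p.2).2 (g.hasFDerivAt (x' + p.2))
    exact (h1.mul h2).mul_const _
  have main := hasFDerivAt_integral_of_dominated_of_fderiv_le (𝕜 := ℝ)
    (Metric.ball_mem_nhds x one_pos)
    (Filter.Eventually.of_forall fun x =>
      (integrable_moyal_integrand θ ha hg x).aestronglyMeasurable)
    (integrable_moyal_integrand θ ha hg x) hcont.aestronglyMeasurable
    (ae_of_all _ hle) hbound (ae_of_all _ hdiff)
  refine ⟨(((Real.pi * θ) ^ 2)⁻¹ : ℝ) • ∫ p, F' x p ∂(volume.prod volume), ?_, fun μ => ?_⟩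
  · rw [show moyal θ a g = _ from funext fun x => moyal_eq_integral_prod θ ha hg x]
    exact main.fun_const_smul _
  · rw [moyal_eq_integral_prod θ (integrable_pd μ a) hg,
      moyal_eq_integral_prod θ ha (integrable_pd μ g), ← smul_add,
      ← integral_add (integrable_moyal_integrand θ (integrable_pd μ a) hg x)
        (integrable_moyal_integrand θ ha (integrable_pd μ g) x),
      _root_.smul_apply, ContinuousLinearMap.integral_apply hF'int]
    congr 2
    ext p
    simp only [F', pd, _root_.smul_apply, _root_.add_apply, smul_eq_mul]
    ring

lemma Dxi_apply {θ ξ : ℝ} {Ψ : E2 → Fin 2 → ℂ} {x : E2}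
    (hΨ : ∀ j, DifferentiableAt ℝ (fun y => Ψ y j) x) (i : Fin 2) :
    Dxi θ ξ Ψ x i = ∑ μ, ∑ j, σv μ i j *
      (-I * pd μ (fun y => Ψ y j) x + ξ * (xt θ μ x * Ψ x j)) := by
  have hpd (μ j : Fin 2) : pd μ Ψ x j = pd μ (fun y => Ψ y j) x := by
    simp only [pd]
    rw [fderiv_pi hΨ]
    rfl
  simp only [Dxi, Finset.sum_apply, Pi.add_apply, Pi.smul_apply, Matrix.mulVec, dotProduct,
    hpd, Complex.real_smul, smul_eq_mul]
  refine Finset.sum_congr rfl fun μ _ => ?_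
  rw [Finset.mul_sum, ← Finset.sum_add_distrib]
  exact Finset.sum_congr rfl fun j _ => by ring

/-- The commutator of `𝒟_ξ` with left Moyal multiplication:
`𝒟_ξ(a ⋆ Ψ) − a ⋆ (𝒟_ξΨ) = (1−ξ)Σ_μ σ^μ((−i∂_μ a) ⋆ Ψ)`
(which vanishes identically for ξ = 1). -/
theorem Dxi_commutator (θ : ℝ) (hθ : 0 < θ) (ξ : ℝ)
    (a : SchwartzMap E2 ℂ) (Ψ : SchwartzMap E2 (Fin 2 → ℂ)) :
    ∀ x : E2, Dxi θ ξ (moyalV θ (⇑a) (⇑Ψ)) x - moyalV θ (⇑a) (Dxi θ ξ (⇑Ψ)) x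
      = ((1 : ℂ) - (ξ : ℂ)) • ∑ μ : Fin 2,
          (σv μ).mulVec (moyalV θ (fun y => -Complex.I * pd μ (⇑a) y) (⇑Ψ) x) := by
  intro x
  let ψ (j : Fin 2) : SchwartzMap E2 ℂ :=
    Ψ.postcompCLM (ContinuousLinearMap.proj (R := ℝ) (φ := fun _ : Fin 2 => ℂ) j)
  have hψ (j : Fin 2) : (fun y => Ψ y j) = ψ j := rfl
  have ha : Integrable a := a.integrable
  choose L hL hLμ using fun j => hasFDerivAt_moyal θ a (ψ j) x
  have hpd (μ j : Fin 2) : pd μ (moyal θ a (ψ j)) x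
      = moyal θ (pd μ a) (ψ j) x + moyal θ a (pd μ (ψ j)) x := by
    rw [pd, (hL j).fderiv, hLμ]
  have hterm (μ j : Fin 2) : Integrable fun y =>
      -I * pd μ (ψ j) y + ξ * (xt θ μ y * ψ j y) :=
    ((integrable_pd μ (ψ j)).const_mul _).add ((integrable_xt_mul θ μ (ψ j)).const_mul _)
  have hright (i : Fin 2) : moyalV θ a (Dxi θ ξ Ψ) x i = ∑ μ, ∑ j, σv μ i j *
      (-I * moyal θ a (pd μ (ψ j)) x
        + ξ * (xt θ μ x * moyal θ a (ψ j) x - I * moyal θ (pd μ a) (ψ j) x)) := by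
    have hD : (fun y => Dxi θ ξ Ψ y i) = fun y => ∑ μ, ∑ j, σv μ i j *
        (-I * pd μ (ψ j) y + ξ * (xt θ μ y * ψ j y)) :=
      funext fun y => Dxi_apply (fun j => (ψ j).differentiableAt) i
    rw [moyalV, hD, moyal_sum_right _ θ ha fun μ _ =>
      integrable_finsetSum _ fun j _ => (hterm μ j).const_mul _]
    refine Finset.sum_congr rfl fun μ _ => ?_
    rw [moyal_sum_right _ θ ha fun j _ => (hterm μ j).const_mul _]
    refine Finset.sum_congr rfl fun j _ => ?_
    rw [moyal_const_mul_right, moyal_add_right θ ha ((integrable_pd μ (ψ j)).const_mul _)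
      ((integrable_xt_mul θ μ (ψ j)).const_mul _), moyal_const_mul_right, moyal_const_mul_right,
      moyal_xt_mul_right]
  ext i
  rw [Pi.sub_apply, hright, Dxi_apply (Ψ := moyalV θ a Ψ) (fun j => (hL j).differentiableAt)]
  simp only [Pi.smul_apply, Finset.sum_apply, Matrix.mulVec, dotProduct, moyalV, hψ,
    moyal_const_mul_left, smul_eq_mul, Finset.mul_sum, ← Finset.sum_sub_distrib]
  refine Finset.sum_congr rfl fun μ _ => Finset.sum_congr rfl fun j _ => ?_
  rw [hpd]
  ring

end
end
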